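/- arXiv:1912.08036 — 2 statements merged into one kernel-verified Lean document; each statement's English description precedes it below -/
import Mathlib

section
/- Let ι be a finite type, m : ι → ℝ with m j > 0 for all j (lumped mass weights), and let L : (ι → ℝ) → ℝ be a linear functional. Let φ : ι → ℝ with φ j ≥ 0 for all j. Suppose Σ : ι → ℝ and Σ' : ι → ℝ each satisfy the variational inequality: for every w : ι → ℝ with w j ≥ 0 for all j, L(w - φ) - ∑_j m j · Σ j · (w j - φ j) ≥ 0 (and the same inequality with Σ replaced by Σ'). Then Σ j = Σ' j for every j with φ j > 0. -/
/-- At a node with `φ j > 0` the variational inequality determines `m j * S j`. -/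
lemma node_eq {ι : Type*} [Fintype ι] [DecidableEq ι]
    (m : ι → ℝ) (L : (ι → ℝ) →ₗ[ℝ] ℝ)
    (φ : ι → ℝ) (hφ : ∀ j, 0 ≤ φ j) (S : ι → ℝ)
    (h : ∀ w : ι → ℝ, (∀ j, 0 ≤ w j) →
      0 ≤ L (w - φ) - ∑ j, m j * S j * (w j - φ j))
    (j : ι) (hj : 0 < φ j) : L (Pi.single j 1) = m j * S j := by
  have key : ∀ t : ℝ, -φ j ≤ t → 0 ≤ t * (L (Pi.single j 1) - m j * S j) := by
    intro t ht
    have h0 := h (φ + t • Pi.single j 1) (by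
      intro k
      by_cases hk : k = j
      · subst hk
        simp
        linarith
      · simpa [hk] using hφ k)
    have hs : ∑ k, m k * S k * ((φ + t • (Pi.single j 1 : ι → ℝ)) k - φ k)
        = m j * S j * t := by
      rw [Finset.sum_eq_single j]
      · simp
      · intro k _ hk
        simp [hk]
      · simp
    rw [hs, add_sub_cancel_left, map_smul, smul_eq_mul] at h0
    linarith
  have a := key (φ j) (by linarith)
  have b := key (-φ j) le_rfl
  have c : φ j * (L (Pi.single j 1) - m j * S j) = 0 := by linarith
  rcases mul_eq_zero.mp c with c | c <;> linarith

/-- Uniqueness of the discrete chemical potential (Remark 2.1): if `Sig` and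
`Sig'` both satisfy the variational inequality
`L (w - φ) - ∑ j, m j * Sig j * (w j - φ j) ≥ 0` for all nonnegative test
vectors `w`, where the lumped mass weights `m j` are positive and `φ` is
nonnegative, then `Sig j = Sig' j` at every node `j` with `φ j > 0`. -/
theorem chemical_potential_unique
    {ι : Type*} [Fintype ι]
    (m : ι → ℝ) (hm : ∀ j, 0 < m j)
    (L : (ι → ℝ) →ₗ[ℝ] ℝ)
    (φ : ι → ℝ) (hφ : ∀ j, 0 ≤ φ j)
    (Sig Sig' : ι → ℝ)
    (h1 : ∀ w : ι → ℝ, (∀ j, 0 ≤ w j) →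
      0 ≤ L (w - φ) - ∑ j, m j * Sig j * (w j - φ j))
    (h2 : ∀ w : ι → ℝ, (∀ j, 0 ≤ w j) →
      0 ≤ L (w - φ) - ∑ j, m j * Sig' j * (w j - φ j)) :
    ∀ j, 0 < φ j → Sig j = Sig' j := by
  classical
  intro j hj
  have a := node_eq m L φ hφ Sig h1 j hj
  have b := node_eq m L φ hφ Sig' h2 j hj
  exact mul_left_cancel₀ (hm j).ne' (a.symm.trans b)
end

section
/- Let N and m be natural numbers, U an N×m real matrix, and p : Fin m → Fin N an injective selection such that the m×m matrix M with entries M i j = U (p i) j is invertible. Let u : Fin N → ℝ, let c = M⁻¹ · (u ∘ p), and let r = u - U·c be the DEIM residual. Suppose l : Fin N satisfies r l ≠ 0. Then: (a) r (p i) = 0 for every i : Fin m (hence l is not in the range of p), and (b) the (m+1)×(m+1) matrix M' obtained by appending u as a new column to U and l as a new selected index — that is, M' i j = U (p i) j, M' i m = u (p i), M' m j = U l j, M' m m = u l for i, j < m — is invertible. -/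
/-- Well-definedness of the DEIM greedy step: the residual
`r = u - U (Pᵀ U)⁻¹ Pᵀ u` vanishes at all already-selected indices, hence a
new index `l` with `r l ≠ 0` is not among them, and the `(m+1) × (m+1)`
matrix obtained by appending the column `u` and the row at index `l` is
again invertible. -/
theorem deim_greedy_step
    (N m : ℕ) (U : Matrix (Fin N) (Fin m) ℝ)
    (p : Fin m → Fin N) (hp : Function.Injective p)
    (M : Matrix (Fin m) (Fin m) ℝ) (hM : ∀ i j, M i j = U (p i) j)
    (hMinv : IsUnit M.det)
    (u : Fin N → ℝ)
    (c : Fin m → ℝ) (hc : c = M⁻¹.mulVec (u ∘ p))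
    (r : Fin N → ℝ) (hr : r = u - U.mulVec c)
    (l : Fin N) (hl : r l ≠ 0)
    (M' : Matrix (Fin (m + 1)) (Fin (m + 1)) ℝ)
    (hM'₁ : ∀ i j : Fin m, M' i.castSucc j.castSucc = U (p i) j)
    (hM'₂ : ∀ i : Fin m, M' i.castSucc (Fin.last m) = u (p i))
    (hM'₃ : ∀ j : Fin m, M' (Fin.last m) j.castSucc = U l j)
    (hM'₄ : M' (Fin.last m) (Fin.last m) = u l) :
    (∀ i : Fin m, r (p i) = 0) ∧ l ∉ Set.range p ∧ IsUnit M'.det := by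
  have hMc : M.mulVec c = u ∘ p := by
    rw [hc, Matrix.mulVec_mulVec, Matrix.mul_nonsing_inv _ hMinv, Matrix.one_mulVec]
  have hsum : ∀ i, ∑ j, U (p i) j * c j = u (p i) := by
    intro i
    have h := congrFun hMc i
    simpa [Matrix.mulVec, dotProduct, hM] using h
  have ha : ∀ i : Fin m, r (p i) = 0 := by
    intro i
    simp [hr, Matrix.mulVec, dotProduct, hsum]
  refine ⟨ha, ?_, ?_⟩
  · rintro ⟨i, rfl⟩
    exact hl (ha i)
  · rw [isUnit_iff_ne_zero]
    intro hdet
    obtain ⟨v, hv, hv0⟩ := Matrix.exists_mulVec_eq_zero_iff.mpr hdet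
    apply hv
    have h1 : ∀ i : Fin m,
        ∑ j : Fin m, U (p i) j * v j.castSucc + u (p i) * v (Fin.last m) = 0 := by
      intro i
      have h := congrFun hv0 i.castSucc
      simpa [Matrix.mulVec, dotProduct, Fin.sum_univ_castSucc, hM'₁, hM'₂] using h
    have h2 : ∑ j : Fin m, U l j * v j.castSucc + u l * v (Fin.last m) = 0 := by
      have h := congrFun hv0 (Fin.last m)
      simpa [Matrix.mulVec, dotProduct, Fin.sum_univ_castSucc, hM'₃, hM'₄] using h
    have h3 : (fun j : Fin m => v j.castSucc + c j * v (Fin.last m)) = 0 := by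
      apply Matrix.eq_zero_of_mulVec_eq_zero hMinv.ne_zero
      funext i
      have h := h1 i
      rw [← hsum i, Finset.sum_mul, ← Finset.sum_add_distrib] at h
      simp only [Matrix.mulVec, dotProduct, hM, Pi.zero_apply]
      rw [← h]
      exact Finset.sum_congr rfl fun j _ => by ring
    have h4 : ∀ j : Fin m, v j.castSucc = -(c j * v (Fin.last m)) := fun j =>
      eq_neg_of_add_eq_zero_left (congrFun h3 j)
    have h5 : r l * v (Fin.last m) = 0 := by
      rw [← h2]
      simp only [hr, Pi.sub_apply, Matrix.mulVec, dotProduct, h4, sub_mul, Finset.sum_mul,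
        mul_neg, Finset.sum_neg_distrib, mul_assoc]
      ring
    have h6 : v (Fin.last m) = 0 := (mul_eq_zero.mp h5).resolve_left hl
    funext k
    refine Fin.lastCases h6 (fun j => ?_) k
    simp [h4, h6]
end
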